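/- Let S = ((n₁,m₁),…,(n_k,m_k)) be a shape with m₁ = 1 and n₁ ≥ 2, let N = Σᵢ nᵢmᵢ, and let d be an integer with d ≥ N − n₁. Then C(N,2) − C(n₁,2) + 1 + Σ_{i=2}^k nᵢ·C(mᵢ+1,2) ≤ N·d + 1, and equality holds if and only if d = N − n₁ and Σ_{i=2}^k nᵢ ≤ 1. -/

import Mathlib

/-- A weighted sum of squares of positive integers is at most the square of the weighted sum. -/
lemma sum_mul_sq_le_sq_sum {ι : Type*} (s : Finset ι) (n m : ι → ℕ)
    (hn : ∀ i ∈ s, 0 < n i) :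
    ∑ i ∈ s, n i * m i ^ 2 ≤ (∑ i ∈ s, n i * m i) ^ 2 := by
  rw [sq, Finset.sum_mul]
  refine Finset.sum_le_sum fun i hi => ?_
  have h : n i * m i ≤ ∑ j ∈ s, n j * m j :=
    Finset.single_le_sum (f := fun j => n j * m j) (fun _ _ => Nat.zero_le _) hi
  have h' : m i ≤ ∑ j ∈ s, n j * m j := (Nat.le_mul_of_pos_left _ (hn i hi)).trans h
  calc n i * m i ^ 2 = n i * m i * m i := by ring
    _ ≤ _ := Nat.mul_le_mul_left _ h'

/-- Equality in `sum_mul_sq_le_sq_sum` holds exactly when the total weight is at most one. -/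
lemma sum_mul_sq_eq_sq_sum_iff {ι : Type*} (s : Finset ι) (n m : ι → ℕ)
    (hn : ∀ i ∈ s, 0 < n i) (hm : ∀ i ∈ s, 0 < m i) :
    ∑ i ∈ s, n i * m i ^ 2 = (∑ i ∈ s, n i * m i) ^ 2 ↔ ∑ i ∈ s, n i ≤ 1 := by
  classical
  constructor
  · intro h
    rcases s.eq_empty_or_nonempty with rfl | ⟨i, hi⟩
    · simp
    have hle := sum_mul_sq_le_sq_sum (s.erase i) n m
      fun j hj => hn j (Finset.mem_of_mem_erase hj)
    rw [← Finset.add_sum_erase s _ hi, ← Finset.add_sum_erase s _ hi] at h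
    have hpos : 0 < n i * m i := Nat.mul_pos (hn i hi) (hm i hi)
    have hrest : ∑ j ∈ s.erase i, n j * m j = 0 := by
      have : n i * m i ^ 2 ≤ (n i * m i) ^ 2 := by nlinarith [hn i hi, sq_nonneg (m i)]
      by_contra hne
      nlinarith [Nat.mul_pos hpos (Nat.pos_of_ne_zero hne)]
    have hempty : s.erase i = ∅ := by
      by_contra hne
      obtain ⟨j, hj⟩ := Finset.nonempty_iff_ne_empty.mpr hne
      have hj' := Finset.mem_of_mem_erase hj
      exact (Nat.mul_pos (hn j hj') (hm j hj')).ne' (Finset.sum_eq_zero_iff.mp hrest j hj)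
    rw [← Finset.add_sum_erase s _ hi, hempty, Finset.sum_empty, add_zero]
    rw [hempty, Finset.sum_empty, Finset.sum_empty, add_zero, add_zero] at h
    have hm2 : 0 < n i * m i ^ 2 := Nat.mul_pos (hn i hi) (pow_pos (hm i hi) 2)
    by_contra! hlt
    nlinarith
  · intro h
    have hcard : s.card ≤ 1 := by
      refine le_trans ?_ h
      rw [Finset.card_eq_sum_ones]
      exact Finset.sum_le_sum hn
    rcases s.eq_empty_or_nonempty with rfl | hne
    · simp
    obtain ⟨i, rfl⟩ := Finset.card_eq_one.mp (le_antisymm hcard hne.card_pos)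
    have hi : n i = 1 := le_antisymm (by simpa using h) (hn i (by simp))
    simp [hi]

lemma two_mul_choose_two (a : ℕ) : 2 * (a.choose 2 : ℤ) = a * (a - 1) := by
  induction a with
  | zero => simp
  | succ a ih =>
    rw [Nat.choose_succ_succ' a 1, Nat.choose_one_right]
    push_cast
    linarith

/-- Let `S = ((n₁,m₁),…,(n_k,m_k))` be a shape (all `nᵢ, mᵢ` positive,
`k ≥ 1`) with `m₁ = 1` and `n₁ ≥ 2`, let `N = Σᵢ nᵢmᵢ`, and let `d` be an integer with
`d ≥ N − n₁`.  Then `C(N,2) − C(n₁,2) + 1 + Σ_{i=2}^k nᵢ·C(mᵢ+1,2) ≤ N·d + 1`, with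
equality if and only if `d = N − n₁` and `Σ_{i=2}^k nᵢ ≤ 1`. -/
theorem shape_bound_m1_eq_one
    (k : ℕ) (hk : 0 < k) (n m : Fin k → ℕ)
    (hn : ∀ i, 0 < n i) (hm : ∀ i, 0 < m i)
    (N : ℕ) (hN : N = ∑ i, n i * m i)
    (hm1 : m ⟨0, hk⟩ = 1) (hn1 : 2 ≤ n ⟨0, hk⟩)
    (d : ℤ) (hd : (N : ℤ) - (n ⟨0, hk⟩ : ℤ) ≤ d) :
    (N.choose 2 : ℤ) - ((n ⟨0, hk⟩).choose 2 : ℤ) + 1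
        + ∑ i ∈ Finset.univ.erase ⟨0, hk⟩, (n i : ℤ) * ((m i + 1).choose 2 : ℤ)
      ≤ (N : ℤ) * d + 1 ∧
    ((N.choose 2 : ℤ) - ((n ⟨0, hk⟩).choose 2 : ℤ) + 1
        + ∑ i ∈ Finset.univ.erase ⟨0, hk⟩, (n i : ℤ) * ((m i + 1).choose 2 : ℤ)
      = (N : ℤ) * d + 1 ↔
      d = (N : ℤ) - (n ⟨0, hk⟩ : ℤ) ∧ ∑ i ∈ Finset.univ.erase ⟨0, hk⟩, n i ≤ 1) := by
  set s := Finset.univ.erase (⟨0, hk⟩ : Fin k)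
  set a := n ⟨0, hk⟩
  set M := ∑ i ∈ s, n i * m i with hM
  set P := ∑ i ∈ s, n i * m i ^ 2 with hP
  have hNM : N = a + M := by
    rw [hN, ← Finset.add_sum_erase _ _ (Finset.mem_univ (⟨0, hk⟩ : Fin k)), hm1, mul_one]
  have hQ : 2 * ∑ i ∈ s, (n i : ℤ) * ((m i + 1).choose 2 : ℤ) = P + M := by
    rw [hP, hM]
    push_cast
    rw [Finset.mul_sum, ← Finset.sum_add_distrib]
    refine Finset.sum_congr rfl fun i _ => ?_
    have := two_mul_choose_two (m i + 1)
    push_cast at this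
    linear_combination (n i : ℤ) * this
  have hle : (P : ℤ) ≤ (M : ℤ) ^ 2 := by
    exact_mod_cast sum_mul_sq_le_sq_sum s n m fun i _ => hn i
  have hiff : (P : ℤ) = (M : ℤ) ^ 2 ↔ ∑ i ∈ s, n i ≤ 1 := by
    rw [← sum_mul_sq_eq_sq_sum_iff s n m (fun i _ => hn i) (fun i _ => hm i)]
    exact_mod_cast Iff.rfl
  have hNc := two_mul_choose_two N
  have hac := two_mul_choose_two a
  have hNz : (N : ℤ) = a + M := by exact_mod_cast hNM
  have hNpos : (0 : ℤ) < N := by omega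
  have hgap : 2 * ((N : ℤ) * d + 1 - ((N.choose 2 : ℤ) - (a.choose 2 : ℤ) + 1
      + ∑ i ∈ s, (n i : ℤ) * ((m i + 1).choose 2 : ℤ)))
      = 2 * (N * (d - (N - a))) + ((M : ℤ) ^ 2 - P) := by
    have hMz : (M : ℤ) = N - a := by linarith
    rw [hMz] at hQ ⊢
    linear_combination -hNc + hac - hQ
  have hdN : 0 ≤ (N : ℤ) * (d - (N - a)) := mul_nonneg hNpos.le (by linarith)
  refine ⟨by linarith, ?_⟩
  rw [← hiff]
  constructor
  · intro h
    have hz : (N : ℤ) * (d - (N - a)) = 0 := by linarith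
    have := (mul_eq_zero.mp hz).resolve_left hNpos.ne'
    constructor <;> linarith
  · rintro ⟨h, hPM⟩
    rw [h, hPM, sub_self, mul_zero, sub_self] at hgap
    rw [h]
    linarith
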